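/- Let n ≥ 1 and let P_n = ⟨a_0, …, a_k⟩ be the n-th P-sequence. Then the function F_{n,n}(x) = ∑_{i=0}^k a_i (i+x)^n is a nonzero constant function on ℝ. -/

import Mathlib

/-- One step of the recursive construction of P-sequences. -/
def Pnext (a : List ℤ) : List ℤ :=
  if a.getLast! = -a.head! then a ++ a.reverse
  else a.dropLast ++ [0] ++ (a.dropLast.reverse.map (fun x => -x))

/-- `Pseq (n-1)` is the `n`-th P-sequence `P_n` (so `Pseq 0 = P_1 = ⟨1,-1⟩`). -/
def Pseq : ℕ → List ℤ
  | 0 => [1, -1]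
  | n + 1 => Pnext (Pseq n)

open Polynomial in
/-- If `f` has degree at most `n + 1`, then `f(X) - f(X + r)` has degree at most `n`. -/
theorem natDegree_sub_taylor_le {n : ℕ} {f : ℝ[X]} (hf : f.natDegree ≤ n + 1) (r : ℝ) :
    (f - taylor r f).natDegree ≤ n := by
  rw [natDegree_le_iff_coeff_eq_zero]
  intro k hk
  rw [coeff_sub, taylor_coeff,
    eq_C_of_natDegree_le_zero ((natDegree_hasseDeriv_le f k).trans (by lia)),
    eval_C, hasseDeriv_coeff]
  simp

open Polynomial in
theorem coeff_sub_taylor {n : ℕ} {f : ℝ[X]} (hf : f.natDegree ≤ n + 1) (r : ℝ) :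
    (f - taylor r f).coeff n = -((n + 1) * r) * f.coeff (n + 1) := by
  rw [coeff_sub, taylor_coeff,
    eq_X_add_C_of_natDegree_le_one ((natDegree_hasseDeriv_le f n).trans (by lia)),
    eval_add, eval_mul, eval_C, eval_X, eval_C, hasseDeriv_coeff, hasseDeriv_coeff,
    add_comm 1 n]
  simp
  ring

/-- The weighted sum `∑ a_i f(i)` over the entries of the list `a`. -/
def weightedSum (a : List ℤ) (f : ℝ → ℝ) : ℝ :=
  ∑ i ∈ Finset.range a.length, (a.getD i 0 : ℝ) * f i

theorem weightedSum_singleton (z : ℤ) (f : ℝ → ℝ) : weightedSum [z] f = z * f 0 := by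
  simp [weightedSum]

theorem weightedSum_append (a b : List ℤ) (f : ℝ → ℝ) :
    weightedSum (a ++ b) f = weightedSum a f + weightedSum b (fun x => f (x + a.length)) := by
  unfold weightedSum
  rw [List.length_append, Finset.sum_range_add]
  congr 1
  · refine Finset.sum_congr rfl fun i hi => ?_
    rw [List.getD_append _ _ _ _ (Finset.mem_range.1 hi)]
  · refine Finset.sum_congr rfl fun i _ => ?_
    rw [List.getD_append_right _ _ _ _ (Nat.le_add_right _ _), Nat.add_sub_cancel_left]
    push_cast
    rw [add_comm (i : ℝ)]

theorem weightedSum_map_neg (a : List ℤ) (f : ℝ → ℝ) :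
    weightedSum (a.map (fun x => -x)) f = -weightedSum a f := by
  unfold weightedSum
  rw [List.length_map, ← Finset.sum_neg_distrib]
  refine Finset.sum_congr rfl fun i hi => ?_
  have hi' := Finset.mem_range.1 hi
  simp [hi']

/-- A list starting with `1`, of length at least two, which is symmetric or antisymmetric. -/
structure IsSymmOrAntisymm (a : List ℤ) : Prop where
  exists_eq_cons : ∃ l, l ≠ [] ∧ a = 1 :: l
  reverse_eq : a.reverse = a ∨ a.reverse = a.map (fun x => -x)

theorem Pnext_of_antisymm {l : List ℤ}
    (h : (1 :: l).reverse = (1 :: l).map (fun x => -x)) :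
    Pnext (1 :: l) = (1 :: l) ++ (1 :: l).map (fun x => -x) := by
  have hlast : (1 :: l).getLast! = -(1 :: l).head! := by
    rw [List.getLast!_eq_getLast?_getD, ← List.head?_reverse, h]
    simp
  rw [Pnext, if_pos hlast, h]

theorem exists_append_of_symm {l : List ℤ} (hl : l ≠ []) (h : (1 :: l).reverse = 1 :: l) :
    ∃ b, 1 :: l = 1 :: b ++ [1] ∧ 1 :: b ++ [1] = [1] ++ (1 :: b).reverse ∧
      Pnext (1 :: l) = 1 :: b ++ [0] ++ (1 :: b).reverse.map (fun x => -x) := by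
  obtain ⟨b, z, rfl⟩ := List.eq_nil_or_concat' l |>.resolve_left hl
  have hz : z = 1 ∧ b.reverse ++ [1] = b ++ [z] := by simpa using h
  obtain ⟨rfl, hb⟩ := hz
  refine ⟨b, rfl, by simp [hb], ?_⟩
  have hlast : (1 :: (b ++ [1])).getLast! ≠ -(1 :: (b ++ [1])).head! := by
    rw [List.getLast!_eq_getLast?_getD, ← List.cons_append, List.getLast?_concat]
    simp
  rw [Pnext, if_neg hlast, ← List.cons_append, List.dropLast_concat]

theorem IsSymmOrAntisymm.next {a : List ℤ} (ha : IsSymmOrAntisymm a) :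
    IsSymmOrAntisymm (Pnext a) := by
  obtain ⟨⟨l, hl, rfl⟩, h | h⟩ := ha
  · obtain ⟨b, -, -, hP⟩ := exists_append_of_symm hl h
    rw [hP]
    refine ⟨⟨_, ?_, by rw [List.append_assoc, List.cons_append]⟩, Or.inr ?_⟩
    · simp
    · simp
  · rw [Pnext_of_antisymm h]
    refine ⟨⟨_, ?_, List.cons_append⟩, Or.inl ?_⟩
    · simp
    · rw [List.reverse_append, ← List.map_reverse, h]
      simp

theorem isSymmOrAntisymm_Pseq (n : ℕ) : IsSymmOrAntisymm (Pseq n) := by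
  induction n with
  | zero => exact ⟨⟨[-1], by simp, rfl⟩, Or.inr (by simp [Pseq])⟩
  | succ n ih => exact ih.next

theorem IsSymmOrAntisymm.exists_weightedSum_Pnext {a : List ℤ} (ha : IsSymmOrAntisymm a) :
    ∃ m : ℕ, m ≠ 0 ∧ ∀ f : ℝ → ℝ,
      weightedSum (Pnext a) f = weightedSum a f - weightedSum a (fun x => f (x + m)) := by
  obtain ⟨⟨l, hl, rfl⟩, h | h⟩ := ha
  · obtain ⟨b, hb, hsymm, hP⟩ := exists_append_of_symm hl h
    refine ⟨(1 :: b).length, by simp, fun f => ?_⟩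
    rw [hP, hb]
    generalize 1 :: b = c at hsymm
    have hfirst : weightedSum (c ++ [1]) f = weightedSum c f + f c.length := by
      simp [weightedSum_append, weightedSum_singleton]
    have hsecond : weightedSum (c ++ [1]) (fun x => f (x + c.length)) =
        f c.length + weightedSum c.reverse (fun x => f (x + (c.length + 1))) := by
      rw [hsymm, weightedSum_append, weightedSum_singleton]
      simp [add_assoc, add_comm (1 : ℝ)]
    rw [hfirst, hsecond, weightedSum_append, weightedSum_append, weightedSum_map_neg,
      weightedSum_singleton]
    simp
    ring
  · refine ⟨(1 :: l).length, by simp, fun f => ?_⟩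
    rw [Pnext_of_antisymm h, weightedSum_append, weightedSum_map_neg, sub_eq_add_neg]

open Polynomial in
/-- On polynomials of degree at most `n + 1`, the functional attached to `Pseq n` is a nonzero
multiple of the coefficient of degree `n + 1`. -/
theorem exists_weightedSum_Pseq_eq (n : ℕ) :
    ∃ c : ℝ, c ≠ 0 ∧ ∀ f : ℝ[X], f.natDegree ≤ n + 1 →
      weightedSum (Pseq n) (fun x => f.eval x) = c * f.coeff (n + 1) := by
  induction n with
  | zero =>
    refine ⟨-1, by norm_num, fun f hf => ?_⟩
    rw [eq_X_add_C_of_natDegree_le_one hf]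
    simp [weightedSum, Pseq, Finset.sum_range_succ]
  | succ n ih =>
    obtain ⟨c, hc, h⟩ := ih
    obtain ⟨m, hm, hP⟩ := (isSymmOrAntisymm_Pseq n).exists_weightedSum_Pnext
    refine ⟨c * -(((n + 1 : ℕ) + 1) * m), ?_, fun f hf => ?_⟩
    · exact mul_ne_zero hc (neg_ne_zero.2 (mul_ne_zero (by positivity) (by exact_mod_cast hm)))
    · rw [Pseq, hP, mul_assoc, ← coeff_sub_taylor hf, ← h _ (natDegree_sub_taylor_le hf _)]
      simp only [weightedSum, ← Finset.sum_sub_distrib, ← mul_sub, eval_sub, taylor_eval]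

/-- for `n ≥ 1` and `P_n = ⟨a_0,…,a_k⟩`, the function
`F_{n,n}(x) = ∑_{i=0}^k a_i (i+x)^n` is a nonzero constant function on `ℝ`. -/
theorem Fnn_const_ne_zero (n : ℕ) (hn : 1 ≤ n) :
    ∃ c : ℝ, c ≠ 0 ∧ ∀ x : ℝ,
      ∑ i ∈ Finset.range (Pseq (n - 1)).length,
        (((Pseq (n - 1)).getD i 0 : ℝ) * ((i : ℝ) + x) ^ n) = c := by
  obtain ⟨n, rfl⟩ : ∃ m, n = m + 1 := ⟨n - 1, by lia⟩
  obtain ⟨c, hc, h⟩ := exists_weightedSum_Pseq_eq n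
  refine ⟨c, hc, fun x => ?_⟩
  have hx := h ((Polynomial.X + Polynomial.C x) ^ (n + 1)) (by simp)
  rw [Polynomial.coeff_X_add_C_pow] at hx
  simpa [weightedSum] using hx
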